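/- Let (X_k)_{1 ≤ k ≤ n} be independent identically distributed real random variables with E[X_1] = 0, E[X_1²] = 1 and E[X_1⁴] < ∞, and let (a_{k,l})_{1 ≤ k,l ≤ n} be a symmetric real matrix with vanishing diagonal, not identically zero. Set Q_n := Σ_{1 ≤ k,l ≤ n} a_{k,l} X_k X_l, assume E[Q_n²] = 1, and let L_n² := max_{1 ≤ k ≤ n} Σ_{l=1}^n a_{k,l}². Then d_W(Q_n, 𝒩) ≤ 2 √n L_n² ( √( E[X_1⁴] + (2/(n L_n⁴)) Σ_{1 ≤ l,p ≤ n} (Σ_{k=1}^n a_{k,l} a_{k,p})² ) + 2 √( 3 E[X_1⁴] + (E[X_1⁴])² ) ). -/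

import Mathlib

open MeasureTheory ProbabilityTheory

/-- Wasserstein distance between two laws on `ℝ`, as a supremum over
1-Lipschitz test functions. -/
noncomputable def dW (μ ν : Measure ℝ) : ℝ :=
  ⨆ h : {f : ℝ → ℝ // LipschitzWith 1 f}, |(∫ x, h.1 x ∂μ) - ∫ x, h.1 x ∂ν|

/-- The standard Gaussian law `N(0,1)` on `ℝ`. -/
noncomputable def stdGaussian : Measure ℝ := gaussianReal 0 1

section Auxiliary

open Set Filter Topology

lemma integrable_gaussianPDFReal_mul {f : ℝ → ℝ} (hf : Integrable f (gaussianReal 0 1)) :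
    Integrable (fun y => gaussianPDFReal 0 1 y * f y) := by
  rw [gaussianReal_of_var_ne_zero _ one_ne_zero,
    integrable_withDensity_iff_integrable_smul' (measurable_gaussianPDF _ _)
      (ae_of_all _ fun _ => gaussianPDF_lt_top)] at hf
  simpa [toReal_gaussianPDF] using hf

lemma setIntegral_gaussianReal {f : ℝ → ℝ} {s : Set ℝ} (hs : MeasurableSet s) :
    ∫ y in s, f y ∂(gaussianReal 0 1) = ∫ y in s, gaussianPDFReal 0 1 y * f y := by
  rw [gaussianReal_of_var_ne_zero _ one_ne_zero,
    setIntegral_withDensity_eq_setIntegral_toReal_smul (measurable_gaussianPDF _ _)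
      (ae_of_all _ fun _ => gaussianPDF_lt_top) _ hs]
  simp [toReal_gaussianPDF]

lemma integrable_pow_gaussianReal (n : ℕ) :
    Integrable (fun y : ℝ => y ^ n) (gaussianReal 0 1) := by
  have h := (memLp_id_gaussianReal (μ := 0) (v := 1) n).integrable_norm_pow'
  refine h.mono' (by fun_prop) (ae_of_all _ fun y => ?_)
  simp

lemma integrable_id_gaussianReal :
    Integrable (fun y : ℝ => y) (gaussianReal 0 1) := by
  simpa using integrable_pow_gaussianReal 1

lemma hasDerivAt_gaussianPDFReal (x : ℝ) :
    HasDerivAt (gaussianPDFReal 0 1) (-x * gaussianPDFReal 0 1 x) x := by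
  have h : HasDerivAt (fun y : ℝ => -(y - 0) ^ 2 / (2 * (1 : NNReal))) (-x) x := by
    have := (((hasDerivAt_id x).sub_const 0).pow 2).neg.div_const (2 * ((1 : NNReal) : ℝ))
    exact this.congr_deriv (by simp [neg_div])
  have := h.exp.const_mul (√(2 * Real.pi * (1 : NNReal)))⁻¹
  rw [gaussianPDFReal_def]
  exact this.congr_deriv (by ring)

lemma continuous_gaussianPDFReal : Continuous (gaussianPDFReal 0 1) :=
  continuous_iff_continuousAt.2 fun x => (hasDerivAt_gaussianPDFReal x).continuousAt

/-- The first partial moment of the standard Gaussian. -/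
lemma setIntegral_Ioi_id_gaussianReal (x : ℝ) :
    ∫ y in Ioi x, y ∂(gaussianReal 0 1) = gaussianPDFReal 0 1 x := by
  have hd : ∀ y ∈ Ioi x, HasDerivAt (fun y => -gaussianPDFReal 0 1 y)
      (gaussianPDFReal 0 1 y * y) y := fun y _ => by
    exact (hasDerivAt_gaussianPDFReal y).neg.congr_deriv (by ring)
  have hi : IntegrableOn (fun y => gaussianPDFReal 0 1 y * y) (Ioi x) :=
    (integrable_gaussianPDFReal_mul integrable_id_gaussianReal).integrableOn
  have hi' : IntegrableOn (fun y => -gaussianPDFReal 0 1 y) (Ioi x) :=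
    (integrable_gaussianPDFReal 0 1).neg.integrableOn
  rw [setIntegral_gaussianReal measurableSet_Ioi,
    integral_Ioi_of_hasDerivAt_of_tendsto continuous_gaussianPDFReal.neg.continuousWithinAt hd hi
      (tendsto_zero_of_hasDerivAt_of_integrableOn_Ioi hd hi hi')]
  simp

/-- The second partial moment of the standard Gaussian. -/
lemma setIntegral_Ioi_sq_gaussianReal (x : ℝ) :
    ∫ y in Ioi x, y ^ 2 ∂(gaussianReal 0 1) =
      (gaussianReal 0 1).real (Ioi x) + x * gaussianPDFReal 0 1 x := by
  have hd : ∀ y ∈ Ioi x, HasDerivAt (fun y => -(gaussianPDFReal 0 1 y * y))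
      (gaussianPDFReal 0 1 y * (y ^ 2 - 1)) y := fun y _ => by
    exact ((hasDerivAt_gaussianPDFReal y).mul (hasDerivAt_id y)).neg.congr_deriv
      (by simp only [id]; ring)
  have hsub : Integrable (fun y : ℝ => y ^ 2 - 1) (gaussianReal 0 1) :=
    (integrable_pow_gaussianReal 2).sub (integrable_const _)
  have hi : IntegrableOn (fun y => gaussianPDFReal 0 1 y * (y ^ 2 - 1)) (Ioi x) :=
    (integrable_gaussianPDFReal_mul hsub).integrableOn
  have hi' : IntegrableOn (fun y => -(gaussianPDFReal 0 1 y * y)) (Ioi x) :=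
    (integrable_gaussianPDFReal_mul integrable_id_gaussianReal).neg.integrableOn
  have hc : Continuous (fun y => -(gaussianPDFReal 0 1 y * y)) := by
    have := continuous_gaussianPDFReal
    fun_prop
  have h := integral_Ioi_of_hasDerivAt_of_tendsto hc.continuousWithinAt hd hi
      (tendsto_zero_of_hasDerivAt_of_integrableOn_Ioi hd hi hi')
  rw [← setIntegral_gaussianReal measurableSet_Ioi,
    integral_sub (integrable_pow_gaussianReal 2).integrableOn
      (integrable_const _).integrableOn] at h
  simp at h
  linarith

lemma setIntegral_Iic_gaussianReal {f : ℝ → ℝ} (hf : Integrable f (gaussianReal 0 1)) (x : ℝ) :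
    ∫ y in Iic x, f y ∂(gaussianReal 0 1) =
      ∫ y, f y ∂(gaussianReal 0 1) - ∫ y in Ioi x, f y ∂(gaussianReal 0 1) := by
  rw [← integral_add_compl (measurableSet_Iic (a := x)) hf, compl_Iic]
  ring

lemma integral_sq_gaussianReal : ∫ y, y ^ 2 ∂(gaussianReal 0 1) = 1 := by
  have h := variance_fun_id_gaussianReal (μ := 0) (v := 1)
  rw [variance_eq_integral (by fun_prop)] at h
  simpa using h

lemma gaussianReal_Iic_add_Ioi (x : ℝ) :
    (gaussianReal 0 1).real (Iic x) + (gaussianReal 0 1).real (Ioi x) = 1 := by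
  rw [← compl_Iic]
  exact probReal_add_probReal_compl measurableSet_Iic

lemma setIntegral_gaussianReal_sub_sq (s : Set ℝ) (t : ℝ) :
    ∫ y in s, (y - t) ^ 2 ∂(gaussianReal 0 1) =
      ∫ y in s, y ^ 2 ∂(gaussianReal 0 1) - 2 * t * ∫ y in s, y ∂(gaussianReal 0 1) +
        t ^ 2 * (gaussianReal 0 1).real s := by
  have h (y : ℝ) : (y - t) ^ 2 = y ^ 2 - 2 * t * y + t ^ 2 := by ring
  have h2 := (integrable_pow_gaussianReal 2).integrableOn (s := s)
  have h1 := (integrable_id_gaussianReal.const_mul (2 * t)).integrableOn (s := s)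
  have h12 : IntegrableOn (fun y => y ^ 2 - 2 * t * y) s (gaussianReal 0 1) := h2.sub h1
  simp_rw [h]
  rw [integral_add h12 (integrable_const _), integral_sub h2 h1, integral_const_mul]
  simp [mul_comm]

/-- Cauchy-Schwarz on a set: the square of a partial first moment is bounded by the mass times the
partial second moment. -/
lemma sq_setIntegral_le_gaussianReal (s : Set ℝ) :
    (∫ y in s, y ∂(gaussianReal 0 1)) ^ 2 ≤
      (gaussianReal 0 1).real s * ∫ y in s, y ^ 2 ∂(gaussianReal 0 1) := by
  have h := discrim_le_zero (a := (gaussianReal 0 1).real s)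
    (b := -2 * ∫ y in s, y ∂(gaussianReal 0 1)) (c := ∫ y in s, y ^ 2 ∂(gaussianReal 0 1))
    fun t => by
      have : 0 ≤ ∫ y in s, (y - t) ^ 2 ∂(gaussianReal 0 1) :=
        integral_nonneg fun _ => sq_nonneg _
      rw [setIntegral_gaussianReal_sub_sq] at this
      linarith
  rw [discrim] at h
  linarith

/-- The inequalities between the density and the tails of the standard Gaussian used to bound
solutions of the Stein equation. -/
lemma gaussian_tail_bounds (x : ℝ) {p q φ : ℝ} (hp : p = (gaussianReal 0 1).real (Iic x))
    (hq : q = (gaussianReal 0 1).real (Ioi x)) (hφ : φ = gaussianPDFReal 0 1 x) :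
    p + q = 1 ∧ 0 ≤ x * p + φ ∧ 0 ≤ φ - x * q ∧ 0 ≤ (1 + x ^ 2) * q - x * φ ∧
      0 ≤ (1 + x ^ 2) * p + x * φ ∧ 2 * (x * p + φ) * (φ - x * q) ≤ φ := by
  have hpq : p + q = 1 := by rw [hp, hq, gaussianReal_Iic_add_Ioi]
  have hp0 : 0 ≤ p := hp ▸ measureReal_nonneg
  have hq0 : 0 ≤ q := hq ▸ measureReal_nonneg
  have hφ0 : 0 < φ := hφ ▸ gaussianPDFReal_pos _ _ _ one_ne_zero
  have m1 := setIntegral_Ioi_id_gaussianReal x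
  have m2 := setIntegral_Ioi_sq_gaussianReal x
  have l1 := setIntegral_Iic_gaussianReal integrable_id_gaussianReal x
  have l2 := setIntegral_Iic_gaussianReal (integrable_pow_gaussianReal 2) x
  rw [integral_id_gaussianReal] at l1
  rw [integral_sq_gaussianReal] at l2
  have c1 := sq_setIntegral_le_gaussianReal (Ioi x)
  have c2 := sq_setIntegral_le_gaussianReal (Iic x)
  have s1 := setIntegral_gaussianReal_sub_sq (Ioi x) x
  have s2 := setIntegral_gaussianReal_sub_sq (Iic x) x
  have n1 : 0 ≤ ∫ y in Ioi x, (y - x) ^ 2 ∂(gaussianReal 0 1) :=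
    integral_nonneg fun _ => sq_nonneg _
  have n2 : 0 ≤ ∫ y in Iic x, (y - x) ^ 2 ∂(gaussianReal 0 1) :=
    integral_nonneg fun _ => sq_nonneg _
  have b1 : 0 ≤ ∫ y in Ioi x, (y - x) ∂(gaussianReal 0 1) :=
    setIntegral_nonneg measurableSet_Ioi fun y hy => sub_nonneg.2 (le_of_lt hy)
  have b2 : 0 ≤ ∫ y in Iic x, (x - y) ∂(gaussianReal 0 1) :=
    setIntegral_nonneg measurableSet_Iic fun y hy => sub_nonneg.2 hy
  rw [integral_sub integrable_id_gaussianReal.integrableOn (integrable_const _)] at b1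
  rw [integral_sub (integrable_const _) integrable_id_gaussianReal.integrableOn] at b2
  simp only [integral_const, measureReal_restrict_apply_univ, smul_eq_mul] at b1 b2
  simp only [l1, l2, m1, m2, ← hp, ← hq, ← hφ] at c1 c2 s1 s2 b1 b2
  have hα : 0 ≤ x * p + φ := by linarith
  have hβ : 0 ≤ φ - x * q := by linarith
  refine ⟨hpq, hα, hβ, by linarith, by nlinarith, ?_⟩
  obtain ⟨α, hαd⟩ : ∃ α, α = x * p + φ := ⟨_, rfl⟩
  obtain ⟨β, hβd⟩ : ∃ β, β = φ - x * q := ⟨_, rfl⟩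
  have hφe : φ = α * q + β * p := by
    rw [hαd, hβd]; linear_combination (-φ) * hpq
  rw [← hαd] at hα ⊢
  rw [← hβd] at hβ ⊢
  have e1 : β ^ 2 + x * q * β ≤ q ^ 2 := by
    have : φ = β + x * q := by rw [hβd]; ring
    rw [this] at c1; nlinarith
  have e2 : α ^ 2 - x * p * α ≤ p ^ 2 := by
    have h1 : φ = α - x * p := by rw [hαd]; ring
    have h2 : q = 1 - p := by linarith
    rw [h1, h2] at c2; nlinarith
  have key : α * β ≤ p * q := by
    have h : φ * (α * β) ≤ φ * (p * q) := by
      rw [hφe]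
      nlinarith [mul_le_mul_of_nonneg_left e1 (mul_nonneg hα hp0),
        mul_le_mul_of_nonneg_left e2 (mul_nonneg hβ hq0)]
    exact le_of_mul_le_mul_left h hφ0
  have hsq : (2 * α * β) ^ 2 ≤ φ ^ 2 := by
    rw [hφe]
    nlinarith [mul_le_mul_of_nonneg_left key (mul_nonneg hα hβ), sq_nonneg (α * q - β * p)]
  exact le_of_sq_le_sq hsq hφ0.le

lemma LipschitzWith.abs_sub_le {h : ℝ → ℝ} (hh : LipschitzWith 1 h) (x y : ℝ) :
    |h x - h y| ≤ |x - y| := by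
  simpa [Real.dist_eq] using hh.dist_le_mul x y

lemma LipschitzWith.integrable_comp {Ω : Type*} {mΩ : MeasurableSpace Ω} {μ : Measure Ω}
    [IsFiniteMeasure μ] {h : ℝ → ℝ} (hh : LipschitzWith 1 h) {Y : Ω → ℝ} (hY : Integrable Y μ) :
    Integrable (fun ω => h (Y ω)) μ := by
  refine ((integrable_const |h 0|).add hY.abs).mono'
    (hh.continuous.comp_aestronglyMeasurable hY.1) (ae_of_all _ fun ω => ?_)
  have := hh.abs_sub_le (Y ω) 0
  have := abs_add_le (h (Y ω) - h 0) (h 0)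
  simp only [sub_add_cancel, sub_zero, Pi.add_apply, Real.norm_eq_abs] at *
  linarith

lemma LipschitzWith.abs_setIntegral_Iic_le {h : ℝ → ℝ} (hh : LipschitzWith 1 h) (x : ℝ) :
    |∫ y in Iic x, (h y - h x) ∂(gaussianReal 0 1)| ≤
      x * (gaussianReal 0 1).real (Iic x) + gaussianPDFReal 0 1 x := by
  have hi : Integrable (fun y : ℝ => x - y) ((gaussianReal 0 1).restrict (Iic x)) :=
    ((integrable_const x).sub integrable_id_gaussianReal).integrableOn
  have h1 := norm_integral_le_of_norm_le (f := fun y => h y - h x) hi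
    (ae_restrict_of_forall_mem measurableSet_Iic fun y hy => by
      have := hh.abs_sub_le y x
      rwa [abs_of_nonpos (sub_nonpos.2 (mem_Iic.1 hy)), neg_sub] at this)
  rw [integral_sub (integrable_const _) integrable_id_gaussianReal.integrableOn,
    setIntegral_Iic_gaussianReal integrable_id_gaussianReal, setIntegral_Ioi_id_gaussianReal,
    integral_id_gaussianReal] at h1
  simpa [mul_comm] using h1

lemma LipschitzWith.abs_setIntegral_Ioi_le {h : ℝ → ℝ} (hh : LipschitzWith 1 h) (x : ℝ) :
    |∫ y in Ioi x, (h y - h x) ∂(gaussianReal 0 1)| ≤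
      gaussianPDFReal 0 1 x - x * (gaussianReal 0 1).real (Ioi x) := by
  have hi : Integrable (fun y : ℝ => y - x) ((gaussianReal 0 1).restrict (Ioi x)) :=
    (integrable_id_gaussianReal.sub (integrable_const x)).integrableOn
  have h1 := norm_integral_le_of_norm_le (f := fun y => h y - h x) hi
    (ae_restrict_of_forall_mem measurableSet_Ioi fun y hy => by
      have := hh.abs_sub_le y x
      rwa [abs_of_nonneg (sub_nonneg.2 (mem_Ioi.1 hy).le)] at this)
  rw [integral_sub integrable_id_gaussianReal.integrableOn (integrable_const _),
    setIntegral_Ioi_id_gaussianReal] at h1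
  simpa [mul_comm] using h1

lemma hasDerivAt_setIntegral_Iic_gaussianReal {g : ℝ → ℝ} (hg : Continuous g)
    (hi : Integrable g (gaussianReal 0 1)) (x : ℝ) :
    HasDerivAt (fun x => ∫ y in Iic x, g y ∂(gaussianReal 0 1))
      (gaussianPDFReal 0 1 x * g x) x := by
  have hw := integrable_gaussianPDFReal_mul hi
  have hc : Continuous (fun y => gaussianPDFReal 0 1 y * g y) := continuous_gaussianPDFReal.mul hg
  have h : (fun x => ∫ y in Iic x, g y ∂(gaussianReal 0 1)) = fun x =>
      (∫ y in Iic 0, gaussianPDFReal 0 1 y * g y) +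
        ∫ y in (0 : ℝ)..x, gaussianPDFReal 0 1 y * g y := by
    ext x
    rw [setIntegral_gaussianReal measurableSet_Iic,
      ← intervalIntegral.integral_Iic_sub_Iic hw.integrableOn hw.integrableOn]
    ring
  rw [h]
  exact (intervalIntegral.integral_hasDerivAt_right hw.intervalIntegrable
    (hc.stronglyMeasurableAtFilter _ _) hc.continuousAt).const_add _

/-- For a 1-Lipschitz `h`, the Stein equation `f' x - x * f x = h x - E h(N)` has a solution
with `|f'| ≤ 1` and `f'` 2-Lipschitz. -/
lemma exists_stein_solution {h : ℝ → ℝ} (hh : LipschitzWith 1 h) :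
    ∃ f f' : ℝ → ℝ, (∀ x, HasDerivAt f (f' x) x) ∧ (∀ x, |f' x| ≤ 1) ∧
      (∀ x y, |f' x - f' y| ≤ 2 * |x - y|) ∧
      ∀ x, f' x - x * f x = h x - ∫ y, h y ∂(gaussianReal 0 1) := by
  have hint : Integrable h (gaussianReal 0 1) := hh.integrable_comp integrable_id_gaussianReal
  set m := ∫ y, h y ∂(gaussianReal 0 1) with hm
  set F : ℝ → ℝ := fun x => ∫ y in Iic x, (h y - m) ∂(gaussianReal 0 1) with hF
  set f : ℝ → ℝ := fun x => F x / gaussianPDFReal 0 1 x with hf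
  have hFd (x : ℝ) : HasDerivAt F (gaussianPDFReal 0 1 x * (h x - m)) x :=
    hasDerivAt_setIntegral_Iic_gaussianReal (hh.continuous.sub continuous_const)
      (hint.sub (integrable_const _)) x
  have hφ0 (x : ℝ) : 0 < gaussianPDFReal 0 1 x := gaussianPDFReal_pos _ _ _ one_ne_zero
  have hfd (x : ℝ) : HasDerivAt f (h x - m + x * f x) x := by
    refine ((hFd x).div (hasDerivAt_gaussianPDFReal x) (hφ0 x).ne').congr_deriv ?_
    have := (hφ0 x).ne'
    simp only [hf]
    field_simp
    ring
  have hrep (x : ℝ) : ∃ A B : ℝ,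
      |A| ≤ x * (gaussianReal 0 1).real (Iic x) + gaussianPDFReal 0 1 x ∧
      |B| ≤ gaussianPDFReal 0 1 x - x * (gaussianReal 0 1).real (Ioi x) ∧
      h x - m = -(A + B) ∧
      f x * gaussianPDFReal 0 1 x =
        (gaussianReal 0 1).real (Ioi x) * A - (gaussianReal 0 1).real (Iic x) * B := by
    refine ⟨_, _, hh.abs_setIntegral_Iic_le x, hh.abs_setIntegral_Ioi_le x, ?_⟩
    have hsplit : ∫ y in Iic x, h y ∂(gaussianReal 0 1) + ∫ y in Ioi x, h y ∂(gaussianReal 0 1)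
        = m := by
      rw [setIntegral_Iic_gaussianReal hint]; ring
    have hpq := gaussianReal_Iic_add_Ioi x
    have hFx : f x * gaussianPDFReal 0 1 x = F x := div_mul_cancel₀ _ (hφ0 x).ne'
    rw [hFx, hF]
    simp only
    rw [integral_sub hint.integrableOn (integrable_const _),
      integral_sub hint.integrableOn (integrable_const _),
      integral_sub hint.integrableOn (integrable_const _)]
    simp only [integral_const, measureReal_restrict_apply_univ, smul_eq_mul]
    constructor
    · linear_combination hsplit - h x * hpq
    · linear_combination (gaussianReal 0 1).real (Iic x) * hsplit -
        (∫ y in Iic x, h y ∂(gaussianReal 0 1)) * hpq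
  have hxf (x : ℝ) : |f x + x * (h x - m + x * f x)| ≤ 1 := by
    obtain ⟨A, B, hA, hB, e1, e2⟩ := hrep x
    obtain ⟨hpq, hα, hβ, hc, hc', -⟩ := gaussian_tail_bounds x rfl rfl rfl
    set p := (gaussianReal 0 1).real (Iic x)
    set q := (gaussianReal 0 1).real (Ioi x)
    have hpos := hφ0 x
    set φ := gaussianPDFReal 0 1 x
    have e : (f x + x * (h x - m + x * f x)) * φ =
        ((1 + x ^ 2) * q - x * φ) * A - ((1 + x ^ 2) * p + x * φ) * B := by
      rw [e1]; linear_combination (1 + x ^ 2) * e2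
    have hb : |(f x + x * (h x - m + x * f x)) * φ| ≤ 1 * φ := by
      rw [e]
      calc _ ≤ |((1 + x ^ 2) * q - x * φ) * A| + |((1 + x ^ 2) * p + x * φ) * B| := abs_sub _ _
        _ ≤ ((1 + x ^ 2) * q - x * φ) * (x * p + φ) +
            ((1 + x ^ 2) * p + x * φ) * (φ - x * q) := by
          rw [abs_mul, abs_mul, abs_of_nonneg hc, abs_of_nonneg hc']
          gcongr
        _ = 1 * φ := by linear_combination φ * hpq
    rw [abs_mul, abs_of_pos hpos] at hb
    exact le_of_mul_le_mul_right hb hpos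
  refine ⟨f, fun x => h x - m + x * f x, hfd, fun x => ?_, fun x y => ?_, fun x => by ring⟩
  · obtain ⟨A, B, hA, hB, e1, e2⟩ := hrep x
    obtain ⟨hpq, hα, hβ, -, -, hαβ⟩ := gaussian_tail_bounds x rfl rfl rfl
    set p := (gaussianReal 0 1).real (Iic x)
    set q := (gaussianReal 0 1).real (Ioi x)
    have hpos := hφ0 x
    set φ := gaussianPDFReal 0 1 x
    have e : (h x - m + x * f x) * φ = -((φ - x * q) * A) - (x * p + φ) * B := by
      rw [e1]; linear_combination x * e2
    have hb : |(h x - m + x * f x) * φ| ≤ 1 * φ := by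
      rw [e]
      calc _ ≤ |-((φ - x * q) * A)| + |(x * p + φ) * B| := abs_sub _ _
        _ ≤ (φ - x * q) * (x * p + φ) + (x * p + φ) * (φ - x * q) := by
          rw [abs_neg, abs_mul, abs_mul, abs_of_nonneg hα, abs_of_nonneg hβ]
          gcongr
        _ ≤ 1 * φ := by linarith
    rw [abs_mul, abs_of_pos hpos] at hb
    exact le_of_mul_le_mul_right hb hpos
  · have hg (x : ℝ) : HasDerivAt (fun x => x * f x) (f x + x * (h x - m + x * f x)) x :=
      ((hasDerivAt_id x).mul (hfd x)).congr_deriv (by simp)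
    have h1 := convex_univ.norm_image_sub_le_of_norm_hasDerivWithin_le (C := 1)
      (fun x _ => (hg x).hasDerivWithinAt) (fun x _ => hxf x) (mem_univ y) (mem_univ x)
    have h2 := hh.abs_sub_le x y
    have h3 := abs_add_le (h x - h y) (x * f x - y * f y)
    simp only [Real.norm_eq_abs] at h1
    have : h x - m + x * f x - (h y - m + y * f y) = h x - h y + (x * f x - y * f y) := by ring
    rw [this]
    linarith

lemma sub_le_of_deriv_lipschitz_left {φ g : ℝ → ℝ} {M : ℝ} (hφ : ∀ t, HasDerivAt φ (g t) t)
    (hg : ∀ s t, |g s - g t| ≤ M * |s - t|) {a b : ℝ} (hab : a ≤ b) :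
    φ b - φ a ≤ g a * (b - a) + M * (b - a) ^ 2 / 2 := by
  have hd (t : ℝ) : HasDerivAt (fun t => g a * (t - a) + M * (t - a) ^ 2 / 2 - φ t)
      (g a + M * (t - a) - g t) t := by
    have h1 := (hasDerivAt_id t).sub_const a
    exact (((h1.const_mul (g a)).add (((h1.pow 2).const_mul M).div_const 2)).sub
      (hφ t)).congr_deriv (by simp; ring)
  have hmono : MonotoneOn (fun t => g a * (t - a) + M * (t - a) ^ 2 / 2 - φ t) (Ici a) := by
    refine monotoneOn_of_deriv_nonneg (convex_Ici a)
      (fun t _ => (hd t).continuousAt.continuousWithinAt)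
      (fun t _ => (hd t).differentiableAt.differentiableWithinAt) fun t ht => ?_
    rw [interior_Ici] at ht
    rw [(hd t).deriv]
    have := (le_abs_self _).trans (hg t a)
    rw [abs_of_pos (sub_pos.2 ht)] at this
    linarith
  have := hmono self_mem_Ici hab hab
  simp at this
  linarith

lemma hasDerivAt_neg_comp_neg {φ g : ℝ → ℝ} (hφ : ∀ t, HasDerivAt φ (g t) t) (t : ℝ) :
    HasDerivAt (fun t => -φ (-t)) (g (-t)) t :=
  ((hφ (-t)).comp t (hasDerivAt_neg t)).neg.congr_deriv (by simp)

lemma abs_comp_neg_sub_le {g : ℝ → ℝ} {M : ℝ} (hg : ∀ s t, |g s - g t| ≤ M * |s - t|) (s t : ℝ) :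
    |g (-s) - g (-t)| ≤ M * |s - t| := by
  have := hg (-s) (-t)
  rwa [neg_sub_neg, abs_sub_comm t s] at this

lemma sub_le_of_deriv_lipschitz_right {φ g : ℝ → ℝ} {M : ℝ} (hφ : ∀ t, HasDerivAt φ (g t) t)
    (hg : ∀ s t, |g s - g t| ≤ M * |s - t|) {a b : ℝ} (hab : a ≤ b) :
    φ b - φ a ≤ g b * (b - a) + M * (b - a) ^ 2 / 2 := by
  have := sub_le_of_deriv_lipschitz_left (hasDerivAt_neg_comp_neg hφ) (abs_comp_neg_sub_le hg)
    (neg_le_neg hab)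
  simp only [neg_neg] at this
  have e : -a - -b = b - a := by ring
  rw [e] at this
  linarith

lemma stein_pointwise_bound_of_nonneg {φ g : ℝ → ℝ} {M : ℝ} (hφ : ∀ t, HasDerivAt φ (g t) t)
    (hg : ∀ s t, |g s - g t| ≤ M * |s - t|) {x : ℝ} (hx : 0 ≤ x) :
    x * φ x - g x ≤ x * φ 0 + g 0 * (x ^ 2 - 1) +
      M * (7 / 10 * x ^ 3 + 3 / 5 * (1 - x ^ 2)) := by
  have hM : 0 ≤ M := by
    have := (abs_nonneg _).trans (hg 1 0)
    simpa using this
  rcases le_or_gt x 1 with h1 | h1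
  · have hr := mul_le_mul_of_nonneg_left (sub_le_of_deriv_lipschitz_right hφ hg hx) hx
    have hl := (abs_le.1 (hg x 0)).1
    rw [sub_zero, abs_of_nonneg hx] at hl
    have hx2 : 0 ≤ 1 - x ^ 2 := by nlinarith
    have hpoly : x * (1 - x ^ 2) + x ^ 3 / 2 ≤ 7 / 10 * x ^ 3 + 3 / 5 * (1 - x ^ 2) := by
      nlinarith [mul_nonneg hx (sq_nonneg (x - 18 / 25)), sq_nonneg (x - 18 / 25)]
    nlinarith [mul_le_mul_of_nonneg_left hpoly hM,
      mul_nonneg hx2 (by linarith : 0 ≤ g x - g 0 + M * x)]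
  · have hx0 : 0 < x := by linarith
    obtain ⟨s, hs⟩ : ∃ s, s = x - 1 / x := ⟨_, rfl⟩
    have hxs : x * s = x ^ 2 - 1 := by rw [hs]; field_simp
    have hd : x * (x - s) = 1 := by linarith [hxs, sq x]
    have hs0 : 0 ≤ s := by nlinarith
    have hsx : s ≤ x := by nlinarith
    have hl := mul_le_mul_of_nonneg_left (sub_le_of_deriv_lipschitz_left hφ hg hs0) hx
    have hr := mul_le_mul_of_nonneg_left (sub_le_of_deriv_lipschitz_right hφ hg hsx) hx
    have hpoly : x * s ^ 2 / 2 + (x - s) / 2 ≤ 7 / 10 * x ^ 3 + 3 / 5 * (1 - x ^ 2) := by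
      have : x * (x * s ^ 2 / 2 + (x - s) / 2) ≤
          x * (7 / 10 * x ^ 3 + 3 / 5 * (1 - x ^ 2)) := by
        have e : x * (x * s ^ 2 / 2 + (x - s) / 2) = (x ^ 2 - 1) ^ 2 / 2 + 1 / 2 := by
          linear_combination (x * s + x ^ 2 - 1) / 2 * hxs + hd / 2
        rw [e]
        nlinarith [sq_nonneg (x * (x - 3 / 2)), sq_nonneg (x - 1), mul_pos hx0 hx0]
      exact le_of_mul_le_mul_left this hx0
    have e1 : x * (g 0 * (s - 0) + M * (s - 0) ^ 2 / 2) =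
        g 0 * (x ^ 2 - 1) + M * (x * s ^ 2 / 2) := by
      linear_combination g 0 * hxs
    have e2 : x * (g x * (x - s) + M * (x - s) ^ 2 / 2) = g x + M * ((x - s) / 2) := by
      linear_combination (g x + M * (x - s) / 2) * hd
    rw [e1] at hl
    rw [e2] at hr
    nlinarith [mul_le_mul_of_nonneg_left hpoly hM]

/-- A pointwise comparison which, integrated against a centred law with unit variance, bounds
`E[X φ(X) - φ'(X)]` by `7 / 10 * M * E|X|³` when `φ'` is `M`-Lipschitz. -/
lemma stein_pointwise_bound {φ g : ℝ → ℝ} {M : ℝ} (hφ : ∀ t, HasDerivAt φ (g t) t)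
    (hg : ∀ s t, |g s - g t| ≤ M * |s - t|) (x : ℝ) :
    x * φ x - g x ≤ x * φ 0 + g 0 * (x ^ 2 - 1) +
      M * (7 / 10 * |x| ^ 3 + 3 / 5 * (1 - x ^ 2)) := by
  rcases le_total 0 x with hx | hx
  · rw [abs_of_nonneg hx]
    exact stein_pointwise_bound_of_nonneg hφ hg hx
  · have := stein_pointwise_bound_of_nonneg (hasDerivAt_neg_comp_neg hφ) (abs_comp_neg_sub_le hg)
      (neg_nonneg.2 hx)
    rw [abs_of_nonpos hx]
    simpa using this

section Moments

variable {Ω : Type*} {mΩ : MeasurableSpace Ω} {μ : Measure Ω}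

lemma sq_integral_mul_le {f g : Ω → ℝ} (hf : MemLp f 2 μ) (hg : MemLp g 2 μ) :
    (∫ ω, f ω * g ω ∂μ) ^ 2 ≤ (∫ ω, f ω ^ 2 ∂μ) * ∫ ω, g ω ^ 2 ∂μ := by
  have hfg := hf.integrable_mul hg
  have h := discrim_le_zero (a := ∫ ω, f ω ^ 2 ∂μ) (b := 2 * ∫ ω, f ω * g ω ∂μ)
    (c := ∫ ω, g ω ^ 2 ∂μ) fun t => by
      have h0 : 0 ≤ ∫ ω, (t * f ω + g ω) ^ 2 ∂μ := integral_nonneg fun _ => sq_nonneg _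
      have e : ∫ ω, (t * f ω + g ω) ^ 2 ∂μ =
          ∫ ω, ((t * t * f ω ^ 2 + 2 * t * (f ω * g ω)) + g ω ^ 2) ∂μ := by
        congr 1; ext ω; ring
      have i1 : Integrable (fun ω => t * t * f ω ^ 2) μ := hf.integrable_sq.const_mul _
      have i2 : Integrable (fun ω => 2 * t * (f ω * g ω)) μ := hfg.const_mul _
      have i12 : Integrable (fun ω => t * t * f ω ^ 2 + 2 * t * (f ω * g ω)) μ := i1.add i2
      rw [e, integral_add i12 hg.integrable_sq, integral_add i1 i2,
        integral_const_mul, integral_const_mul] at h0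
      linarith
  rw [discrim] at h
  linarith

lemma memLp_four_of_integrable {X : Ω → ℝ} (hX : Measurable X)
    (h : Integrable (fun ω => X ω ^ 4) μ) : MemLp X 4 μ := by
  have := integrable_norm_rpow_iff (μ := μ) (p := 4) hX.aestronglyMeasurable (by norm_num)
    (by norm_num)
  rw [← this]
  refine h.congr (ae_of_all _ fun ω => ?_)
  norm_num
  rw [← abs_pow, abs_of_nonneg (Even.pow_nonneg (by decide) _)]

lemma MeasureTheory.MemLp.integrable_pow_four {X : Ω → ℝ} (hX : MemLp X 4 μ) :
    Integrable (fun ω => X ω ^ 4) μ := by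
  refine (hX.integrable_norm_pow (p := 4) (by norm_num)).congr (ae_of_all _ fun ω => ?_)
  simp only [Real.norm_eq_abs]
  rw [← abs_pow, abs_of_nonneg (by positivity)]

lemma MeasureTheory.MemLp.sq_memLp_two {X : Ω → ℝ} (hX : MemLp X 4 μ) :
    MemLp (fun ω => X ω ^ 2) 2 μ := by
  rw [memLp_two_iff_integrable_sq (f := fun ω => X ω ^ 2) (hX.1.pow 2)]
  simpa only [← pow_mul] using hX.integrable_pow_four

section Probability

variable [IsProbabilityMeasure μ]

lemma MeasureTheory.MemLp.two_of_four {X : Ω → ℝ} (hX : MemLp X 4 μ) : MemLp X 2 μ :=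
  hX.mono_exponent (by norm_num)

lemma MeasureTheory.MemLp.integrable_abs_pow_three {X : Ω → ℝ} (hX : MemLp X 4 μ) :
    Integrable (fun ω => |X ω| ^ 3) μ := by
  have h := hX.two_of_four.abs.integrable_mul hX.sq_memLp_two
  refine h.congr (ae_of_all _ fun ω => ?_)
  simp only [Pi.mul_apply, Pi.abs_apply]
  rw [← sq_abs (X ω)]
  ring

lemma integral_abs_pow_three_le {X : Ω → ℝ} (hX : MemLp X 4 μ) :
    ∫ ω, |X ω| ^ 3 ∂μ ≤ √((∫ ω, X ω ^ 2 ∂μ) * ∫ ω, X ω ^ 4 ∂μ) := by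
  refine Real.le_sqrt_of_sq_le ?_
  have h := sq_integral_mul_le hX.two_of_four.abs hX.sq_memLp_two
  have e (ω : Ω) : |X| ω * X ω ^ 2 = |X ω| ^ 3 := by
    rw [Pi.abs_apply, ← sq_abs (X ω)]; ring
  simp only [e] at h
  simpa only [Pi.abs_apply, sq_abs, ← pow_mul, Nat.reduceMul] using h

lemma integral_abs_le_sqrt {X : Ω → ℝ} (hX : MemLp X 2 μ) :
    ∫ ω, |X ω| ∂μ ≤ √(∫ ω, X ω ^ 2 ∂μ) := by
  refine Real.le_sqrt_of_sq_le ?_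
  have h := sq_integral_mul_le hX.abs (memLp_const (μ := μ) (p := 2) (1 : ℝ))
  simpa using h

end Probability

section Independence

variable {ι : Type*} [Fintype ι] [DecidableEq ι] {X : ι → Ω → ℝ}

lemma ProbabilityTheory.iIndepFun.indepFun_update (hX : iIndepFun X μ)
    (hm : ∀ i, Measurable (X i)) (k : ι) :
    IndepFun (X k) (fun ω => Function.update (fun i => X i ω) k 0) μ := by
  have h := hX.indepFun_finset {k} (Finset.univ.erase k) (by simp) hm
  let u : (({k} : Finset ι) → ℝ) → ℝ := fun x => x ⟨k, by simp⟩
  let v : (((Finset.univ : Finset ι).erase k : Finset ι) → ℝ) → ι → ℝ := fun x i =>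
    if hi : i ≠ k then x ⟨i, by simp [hi]⟩ else 0
  have hu : Measurable u := measurable_pi_apply _
  have hv : Measurable v := measurable_pi_lambda _ fun i => by
    by_cases hi : i ≠ k
    · simp only [v, hi, ne_eq, not_false_eq_true, dite_true]
      exact measurable_pi_apply _
    · simp only [v, hi, dite_false]
      exact measurable_const
  have e : (fun ω => Function.update (fun i => X i ω) k 0) =
      v ∘ fun ω (i : (Finset.univ.erase k : Finset ι)) => X i ω := by
    ext ω i
    by_cases hi : i = k
    · subst hi; simp [v]
    · simp [v, hi]
  rw [e]
  exact h.comp hu hv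

lemma ProbabilityTheory.iIndepFun.integral_mul_eq_of_update (hX : iIndepFun X μ)
    (hm : ∀ i, Measurable (X i)) (k : ι) {u : ℝ → ℝ} {v : (ι → ℝ) → ℝ} (hu : Measurable u)
    (hv : Measurable v) (hvk : ∀ x, v (Function.update x k 0) = v x) :
    ∫ ω, u (X k ω) * v (fun i => X i ω) ∂μ =
      (∫ ω, u (X k ω) ∂μ) * ∫ ω, v (fun i => X i ω) ∂μ := by
  have h := ((hX.indepFun_update hm k).comp hu hv).integral_mul_eq_mul_integral
    (hu.comp (hm k)).aestronglyMeasurable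
    (hv.comp (measurable_pi_lambda _ fun i => by
      by_cases hi : i = k
      · subst hi; simp
      · simpa [hi] using hm i)).aestronglyMeasurable
  simpa [Function.comp_def, hvk] using h

variable {m4 : ℝ}

lemma integral_mul_eq_zero_of_ne (hX : iIndepFun X μ) (hm : ∀ i, Measurable (X i))
    (hc : ∀ k, ∫ ω, X k ω ∂μ = 0) {i j k l : ι} (hj : j ≠ i) (hk : k ≠ i) (hl : l ≠ i) :
    ∫ ω, X i ω * (X j ω * X k ω * X l ω) ∂μ = 0 := by
  have h := hX.integral_mul_eq_of_update hm i (u := fun x => x) (v := fun x => x j * x k * x l)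
    (by fun_prop) (by fun_prop) (by simp [hj, hk, hl])
  rwa [hc, zero_mul] at h

lemma integral_mul_eq_of_pair (hX : iIndepFun X μ) (hm : ∀ i, Measurable (X i))
    (hc : ∀ k, ∫ ω, X k ω ∂μ = 0) (hv : ∀ k, ∫ ω, X k ω ^ 2 ∂μ = 1)
    (hm4 : ∀ k, ∫ ω, X k ω ^ 4 ∂μ = m4) (i k l : ι) :
    ∫ ω, X i ω * (X i ω * X k ω * X l ω) ∂μ =
      if k = l then (if i = k then m4 else 1) else 0 := by
  split_ifs with hkl hik
  · subst hkl hik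
    rw [← hm4 i]; congr 1; ext ω; ring
  · subst hkl
    have h := hX.integral_mul_eq_of_update hm i (u := fun x => x ^ 2) (v := fun x => x k ^ 2)
      (by fun_prop) (by fun_prop) (by simp [Ne.symm hik])
    rw [hv, hv] at h
    rw [← mul_one (1 : ℝ), ← h]; congr 1; ext ω; ring
  · by_cases hik : i = k
    · subst hik
      have h := integral_mul_eq_zero_of_ne hX hm hc hkl hkl hkl
      rw [← integral_mul_eq_zero_of_ne hX hm hc (i := l) hkl hkl hkl]
      congr 1; ext ω; ring
    · rw [← integral_mul_eq_zero_of_ne hX hm hc (i := k) hik hik (Ne.symm hkl)]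
      congr 1; ext ω; ring

/-- Mixed fourth moments of independent, centred variables with unit variance. -/
lemma integral_mul_four (hX : iIndepFun X μ) (hm : ∀ i, Measurable (X i))
    (hc : ∀ k, ∫ ω, X k ω ∂μ = 0) (hv : ∀ k, ∫ ω, X k ω ^ 2 ∂μ = 1)
    (hm4 : ∀ k, ∫ ω, X k ω ^ 4 ∂μ = m4) (i j k l : ι) :
    ∫ ω, X i ω * (X j ω * X k ω * X l ω) ∂μ =
      (if i = j then (if k = l then 1 else 0) else 0) +
      (if i = k then (if j = l then 1 else 0) else 0) +
      (if i = l then (if j = k then 1 else 0) else 0) +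
      (if i = j then (if i = k then (if i = l then m4 - 3 else 0) else 0) else 0) := by
  by_cases hij : i = j
  · subst hij
    rw [integral_mul_eq_of_pair hX hm hc hv hm4]
    split_ifs <;> first | (exfalso; simp_all; done) | (exfalso; grind) | ring
  by_cases hik : i = k
  · subst hik
    have e : ∫ ω, X i ω * (X j ω * X i ω * X l ω) ∂μ =
        ∫ ω, X i ω * (X i ω * X j ω * X l ω) ∂μ := by
      congr 1; ext ω; ring
    rw [e, integral_mul_eq_of_pair hX hm hc hv hm4]
    split_ifs <;> first | (exfalso; simp_all; done) | (exfalso; grind) | ring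
  by_cases hil : i = l
  · subst hil
    have e : ∫ ω, X i ω * (X j ω * X k ω * X i ω) ∂μ =
        ∫ ω, X i ω * (X i ω * X j ω * X k ω) ∂μ := by
      congr 1; ext ω; ring
    rw [e, integral_mul_eq_of_pair hX hm hc hv hm4]
    split_ifs <;> first | (exfalso; simp_all; done) | (exfalso; grind) | ring
  rw [integral_mul_eq_zero_of_ne hX hm hc (Ne.symm hij) (Ne.symm hik) (Ne.symm hil)]
  simp [hij, hik, hil]

omit [Fintype ι] [DecidableEq ι] in
lemma integrable_mul_four (h4 : ∀ k, MemLp (X k) 4 μ) (i j k l : ι) :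
    Integrable (fun ω => X i ω * (X j ω * X k ω * X l ω)) μ := by
  have hs := ((h4 i).integrable_pow_four.add (h4 j).integrable_pow_four).add
    ((h4 k).integrable_pow_four.add (h4 l).integrable_pow_four)
  refine hs.mono' ((h4 i).1.mul (((h4 j).1.mul (h4 k).1).mul (h4 l).1)) (ae_of_all _ fun ω => ?_)
  simp only [Pi.add_apply, Real.norm_eq_abs]
  rw [abs_le]
  constructor <;>
  nlinarith [sq_nonneg (X i ω * X j ω + X k ω * X l ω), sq_nonneg (X i ω * X j ω - X k ω * X l ω),
    sq_nonneg (X i ω ^ 2 - X j ω ^ 2), sq_nonneg (X k ω ^ 2 - X l ω ^ 2),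
    sq_nonneg (X i ω ^ 2), sq_nonneg (X j ω ^ 2), sq_nonneg (X k ω ^ 2), sq_nonneg (X l ω ^ 2)]

omit [DecidableEq ι] in
lemma sq_quadratic_form (b : ι → ι → ℝ) (x : ι → ℝ) :
    (∑ i, ∑ j, b i j * x i * x j) ^ 2 =
      ∑ i, ∑ j, ∑ k, ∑ l, b i j * b k l * (x i * (x j * x k * x l)) := by
  rw [sq, Finset.sum_mul]
  refine Finset.sum_congr rfl fun i _ => ?_
  rw [Finset.sum_mul]
  refine Finset.sum_congr rfl fun j _ => ?_
  rw [Finset.mul_sum]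
  refine Finset.sum_congr rfl fun k _ => ?_
  rw [Finset.mul_sum]
  refine Finset.sum_congr rfl fun l _ => ?_
  ring

lemma integral_sq_quadratic_form (hX : iIndepFun X μ) (hm : ∀ i, Measurable (X i))
    (hc : ∀ k, ∫ ω, X k ω ∂μ = 0) (hv : ∀ k, ∫ ω, X k ω ^ 2 ∂μ = 1)
    (h4 : ∀ k, MemLp (X k) 4 μ) (hm4 : ∀ k, ∫ ω, X k ω ^ 4 ∂μ = m4) (b : ι → ι → ℝ) :
    ∫ ω, (∑ i, ∑ j, b i j * X i ω * X j ω) ^ 2 ∂μ =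
      (∑ i, b i i) ^ 2 + ∑ i, ∑ j, b i j ^ 2 + ∑ i, ∑ j, b i j * b j i +
        (m4 - 3) * ∑ i, b i i ^ 2 := by
  have hi (i j k l : ι) :
      Integrable (fun ω => b i j * b k l * (X i ω * (X j ω * X k ω * X l ω))) μ :=
    (integrable_mul_four h4 i j k l).const_mul _
  have hi1 (i j k : ι) := integrable_finsetSum Finset.univ fun l _ => hi i j k l
  have hi2 (i j : ι) := integrable_finsetSum Finset.univ fun k _ => hi1 i j k
  have hi3 (i : ι) := integrable_finsetSum Finset.univ fun j _ => hi2 i j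
  simp_rw [sq_quadratic_form b (fun i => X i _)]
  rw [integral_finsetSum _ fun i _ => hi3 i]
  simp_rw [integral_finsetSum _ fun j _ => hi2 _ j, integral_finsetSum _ fun k _ => hi1 _ _ k,
    integral_finsetSum _ fun l _ => hi _ _ _ l, integral_const_mul,
    integral_mul_four hX hm hc hv hm4, mul_add, Finset.sum_add_distrib]
  congr 1
  · congr 1
    · congr 1
      · simp [sq, Finset.sum_mul_sum]
      · simp [sq]
    · simp
  · simp [sq, mul_comm, Finset.mul_sum]

omit [DecidableEq ι] in
lemma memLp_quadratic_form (h4 : ∀ k, MemLp (X k) 4 μ) (b : ι → ι → ℝ) :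
    MemLp (fun ω => ∑ i, ∑ j, b i j * X i ω * X j ω) 2 μ := by
  refine memLp_finsetSum _ fun i _ => memLp_finsetSum _ fun j _ => ?_
  rw [memLp_two_iff_integrable_sq (f := fun ω => b i j * X i ω * X j ω)
    (((h4 i).1.const_mul _).mul (h4 j).1)]
  refine ((integrable_mul_four h4 i i j j).const_mul (b i j ^ 2)).congr (ae_of_all _ fun ω => ?_)
  simp only
  ring

omit [DecidableEq ι] in
lemma memLp_linear_form (h4 : ∀ k, MemLp (X k) 4 μ) (c : ι → ℝ) :
    MemLp (fun ω => ∑ i, c i * X i ω) 4 μ :=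
  memLp_finsetSum _ fun i _ => (h4 i).const_mul (c i)

lemma integral_sq_linear_form [IsProbabilityMeasure μ] (hX : iIndepFun X μ) (hm : ∀ i, Measurable (X i))
    (hc : ∀ k, ∫ ω, X k ω ∂μ = 0) (hv : ∀ k, ∫ ω, X k ω ^ 2 ∂μ = 1)
    (h4 : ∀ k, MemLp (X k) 4 μ) (c : ι → ℝ) :
    ∫ ω, (∑ i, c i * X i ω) ^ 2 ∂μ = ∑ i, c i ^ 2 := by
  have hi (i j : ι) : Integrable (fun ω => c i * c j * (X i ω * X j ω)) μ :=
    ((h4 i).two_of_four.integrable_mul (h4 j).two_of_four).const_mul _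
  have hi1 (i : ι) := integrable_finsetSum Finset.univ fun j _ => hi i j
  have e (ω : Ω) : (∑ i, c i * X i ω) ^ 2 = ∑ i, ∑ j, c i * c j * (X i ω * X j ω) := by
    rw [sq, Finset.sum_mul_sum]
    exact Finset.sum_congr rfl fun i _ => Finset.sum_congr rfl fun j _ => by ring
  have hE (i j : ι) : ∫ ω, X i ω * X j ω ∂μ = if i = j then 1 else 0 := by
    split_ifs with hij
    · subst hij; simpa only [sq] using hv i
    · have h := hX.integral_mul_eq_of_update hm i (u := fun x => x) (v := fun x => x j)
        (by fun_prop) (by fun_prop) (by simp [Ne.symm hij])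
      rwa [hc, zero_mul] at h
  simp_rw [e]
  rw [integral_finsetSum _ fun i _ => hi1 i]
  simp_rw [integral_finsetSum _ fun j _ => hi _ j, integral_const_mul, hE]
  simp [sq]

lemma integral_pow_four_linear_form_le (hX : iIndepFun X μ) (hm : ∀ i, Measurable (X i))
    (hc : ∀ k, ∫ ω, X k ω ∂μ = 0) (hv : ∀ k, ∫ ω, X k ω ^ 2 ∂μ = 1)
    (h4 : ∀ k, MemLp (X k) 4 μ) (hm4 : ∀ k, ∫ ω, X k ω ^ 4 ∂μ = m4) (hm0 : 0 ≤ m4) (c : ι → ℝ) :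
    ∫ ω, (∑ i, c i * X i ω) ^ 4 ∂μ ≤ (3 + m4) * (∑ i, c i ^ 2) ^ 2 := by
  have h := integral_sq_quadratic_form hX hm hc hv h4 hm4 fun i j => c i * c j
  have e (ω : Ω) : (∑ i, ∑ j, c i * c j * X i ω * X j ω) ^ 2 = (∑ i, c i * X i ω) ^ 4 := by
    have : ∑ i, ∑ j, c i * c j * X i ω * X j ω = (∑ i, c i * X i ω) ^ 2 := by
      rw [sq, Finset.sum_mul_sum]
      exact Finset.sum_congr rfl fun i _ => Finset.sum_congr rfl fun j _ => by ring
    rw [this]; ring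
  have e1 : ∑ i, ∑ j, (c i * c j) ^ 2 = (∑ i, c i ^ 2) ^ 2 := by
    rw [sq (∑ i, c i ^ 2), Finset.sum_mul_sum]
    exact Finset.sum_congr rfl fun i _ => Finset.sum_congr rfl fun j _ => by ring
  have e2 : ∑ i, ∑ j, c i * c j * (c j * c i) = (∑ i, c i ^ 2) ^ 2 := by
    rw [← e1]
    exact Finset.sum_congr rfl fun i _ => Finset.sum_congr rfl fun j _ => by ring
  have e3 : ∑ i, (c i * c i) ^ 2 ≤ (∑ i, c i ^ 2) ^ 2 := by
    have := Finset.sum_sq_le_sq_sum_of_nonneg (s := Finset.univ) (f := fun i => c i ^ 2)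
      fun i _ => sq_nonneg _
    refine le_of_eq_of_le (Finset.sum_congr rfl fun i _ => by ring) this
  have e4 : 0 ≤ ∑ i, (c i * c i) ^ 2 := Finset.sum_nonneg fun i _ => sq_nonneg _
  have e5 : ∑ i, c i * c i = ∑ i, c i ^ 2 := by simp only [sq]
  simp only [e] at h
  rw [h, e1, e2, e5]
  nlinarith

end Independence

end Moments

section LeaveOneOut

variable {Ω : Type*} {mΩ : MeasurableSpace Ω} {μ : Measure Ω} [IsProbabilityMeasure μ]

lemma abs_sub_le_of_abs_deriv_le_one {f f' : ℝ → ℝ} (hf : ∀ x, HasDerivAt f (f' x) x)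
    (hf1 : ∀ x, |f' x| ≤ 1) (x y : ℝ) : |f x - f y| ≤ |x - y| := by
  simpa using convex_univ.norm_image_sub_le_of_norm_hasDerivWithin_le (C := 1)
    (fun x _ => (hf x).hasDerivWithinAt) (fun x _ => hf1 x) (mem_univ y) (mem_univ x)

lemma MeasureTheory.MemLp.comp_of_abs_sub_le {f : ℝ → ℝ} (hf : ∀ x y, |f x - f y| ≤ |x - y|)
    {R : Ω → ℝ} (hR : MemLp R 2 μ) : MemLp (fun ω => f (R ω)) 2 μ := by
  have hc : LipschitzWith 1 f := LipschitzWith.of_dist_le_mul fun x y => by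
    simpa [Real.dist_eq] using hf x y
  refine ((memLp_const |f 0|).add hR.abs).mono'
    (hc.continuous.comp_aestronglyMeasurable hR.1) (ae_of_all _ fun ω => ?_)
  have := hf (R ω) 0
  have := abs_add_le (f (R ω) - f 0) (f 0)
  simp only [sub_add_cancel, sub_zero, Pi.add_apply, Pi.abs_apply, Real.norm_eq_abs] at *
  linarith

lemma continuous_of_abs_sub_le {g : ℝ → ℝ} {M : ℝ} (hM : 0 ≤ M)
    (hg : ∀ x y, |g x - g y| ≤ M * |x - y|) : Continuous g :=
  (LipschitzWith.of_dist_le_mul (K := ⟨M, hM⟩) fun x y => by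
    rw [Real.dist_eq, Real.dist_eq]
    exact hg x y).continuous

omit [IsProbabilityMeasure μ] in
lemma MeasureTheory.Integrable.mul_comp_of_abs_le_one {Z W : Ω → ℝ} (hZ : Integrable Z μ)
    (hW : AEStronglyMeasurable W μ) {g : ℝ → ℝ} (hg : Continuous g) (hg1 : ∀ x, |g x| ≤ 1) :
    Integrable (fun ω => Z ω * g (W ω)) μ := by
  refine hZ.norm.mono' (hZ.1.mul (hg.comp_aestronglyMeasurable hW)) (ae_of_all _ fun ω => ?_)
  simp only [norm_mul, Real.norm_eq_abs]
  exact mul_le_of_le_one_right (abs_nonneg _) (hg1 _)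

/-- The error made when replacing `X * Y * f (R + 2 * X * Y)` by `2 * Y ^ 2 * f' (R + 2 * X * Y)`
under the expectation, for a standardised `X` independent of `(Y, R)`. -/
lemma integral_leave_one_out_le {X Y R : Ω → ℝ} (hind : IndepFun X (fun ω => (Y ω, R ω)) μ)
    (hX : MemLp X 4 μ) (hY : MemLp Y 4 μ) (hR : MemLp R 2 μ) (hXm : Measurable X)
    (hYm : Measurable Y) (hRm : Measurable R) (hX0 : ∫ ω, X ω ∂μ = 0)
    (hX1 : ∫ ω, X ω ^ 2 ∂μ = 1) {f f' : ℝ → ℝ} (hf : ∀ x, HasDerivAt f (f' x) x)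
    (hf1 : ∀ x, |f' x| ≤ 1) (hf2 : ∀ x y, |f' x - f' y| ≤ 2 * |x - y|) :
    Integrable (fun ω => X ω * Y ω * f (R ω + 2 * X ω * Y ω)) μ ∧
    Integrable (fun ω => 2 * Y ω ^ 2 * f' (R ω + 2 * X ω * Y ω)) μ ∧
    ∫ ω, (X ω * Y ω * f (R ω + 2 * X ω * Y ω) - 2 * Y ω ^ 2 * f' (R ω + 2 * X ω * Y ω)) ∂μ ≤
      28 / 5 * ((∫ ω, |X ω| ^ 3 ∂μ) * ∫ ω, |Y ω| ^ 3 ∂μ) := by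
  have hfl := abs_sub_le_of_abs_deriv_le_one hf hf1
  have hfc : Continuous f := continuous_iff_continuousAt.2 fun x => (hf x).continuousAt
  have hfc' : Continuous f' := continuous_of_abs_sub_le zero_le_two hf2
  have hXY : MemLp (fun ω => X ω * Y ω) 2 μ := by
    rw [memLp_two_iff_integrable_sq (f := fun ω => X ω * Y ω) (hX.1.mul hY.1)]
    have h := (hind.comp (φ := fun x : ℝ => x ^ 2) (ψ := fun z : ℝ × ℝ => z.1 ^ 2) (by fun_prop)
      (by fun_prop)).integrable_mul hX.two_of_four.integrable_sq hY.two_of_four.integrable_sq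
    refine h.congr (ae_of_all _ fun ω => ?_)
    simp only [Pi.mul_apply, Function.comp_apply]
    ring
  have hQ : MemLp (fun ω => R ω + 2 * X ω * Y ω) 2 μ :=
    hR.add ((hXY.const_mul 2).congr_norm
      (by fun_prop) (ae_of_all _ fun ω => by simp only [mul_assoc]))
  have iL1 : Integrable (fun ω => X ω * Y ω * f (R ω + 2 * X ω * Y ω)) μ :=
    hXY.integrable_mul (hQ.comp_of_abs_sub_le hfl)
  have hY2 : Integrable (fun ω => 2 * Y ω ^ 2) μ := hY.two_of_four.integrable_sq.const_mul 2
  have iL2 : Integrable (fun ω => 2 * Y ω ^ 2 * f' (R ω + 2 * X ω * Y ω)) μ :=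
    hY2.mul_comp_of_abs_le_one hQ.1 hfc' hf1
  have iX2 : Integrable (fun ω => X ω ^ 2 - 1) μ :=
    hX.two_of_four.integrable_sq.sub (integrable_const _)
  have ind1 : IndepFun X (fun ω => Y ω * f (R ω)) μ :=
    hind.comp (φ := fun x : ℝ => x) (ψ := fun z : ℝ × ℝ => z.1 * f z.2) (by fun_prop)
      (by fun_prop)
  have i1 : Integrable (fun ω => X ω * (Y ω * f (R ω))) μ :=
    ind1.integrable_mul (hX.integrable (by norm_num))
      (hY.two_of_four.integrable_mul (hR.comp_of_abs_sub_le hfl))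
  have ind2 : IndepFun (fun ω => X ω ^ 2 - 1) (fun ω => 2 * Y ω ^ 2 * f' (R ω)) μ :=
    hind.comp (φ := fun x : ℝ => x ^ 2 - 1) (ψ := fun z : ℝ × ℝ => 2 * z.1 ^ 2 * f' z.2)
      (by fun_prop) (by fun_prop)
  have i2 : Integrable (fun ω => (X ω ^ 2 - 1) * (2 * Y ω ^ 2 * f' (R ω))) μ :=
    ind2.integrable_mul iX2 (hY2.mul_comp_of_abs_le_one hR.1 hfc' hf1)
  have ind3 : IndepFun (fun ω => |X ω| ^ 3) (fun ω => |Y ω| ^ 3) μ :=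
    hind.comp (φ := fun x : ℝ => |x| ^ 3) (ψ := fun z : ℝ × ℝ => |z.1| ^ 3)
      (by fun_prop) (by fun_prop)
  have i3 : Integrable (fun ω => |X ω| ^ 3 * |Y ω| ^ 3) μ :=
    ind3.integrable_mul hX.integrable_abs_pow_three hY.integrable_abs_pow_three
  have ind4 : IndepFun (fun ω => X ω ^ 2 - 1) (fun ω => |Y ω| ^ 3) μ :=
    hind.comp (φ := fun x : ℝ => x ^ 2 - 1) (ψ := fun z : ℝ × ℝ => |z.1| ^ 3)
      (by fun_prop) (by fun_prop)
  have i4 : Integrable (fun ω => (X ω ^ 2 - 1) * |Y ω| ^ 3) μ :=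
    ind4.integrable_mul iX2 hY.integrable_abs_pow_three
  have z1 : ∫ ω, X ω * (Y ω * f (R ω)) ∂μ = 0 := by
    rw [ind1.integral_fun_mul_eq_mul_integral (by fun_prop) (by fun_prop), hX0, zero_mul]
  have zX : ∫ ω, (X ω ^ 2 - 1) ∂μ = 0 := by
    rw [integral_sub hX.two_of_four.integrable_sq (integrable_const _), hX1]
    simp
  have z2 : ∫ ω, (X ω ^ 2 - 1) * (2 * Y ω ^ 2 * f' (R ω)) ∂μ = 0 := by
    rw [ind2.integral_fun_mul_eq_mul_integral (by fun_prop) (by fun_prop), zX, zero_mul]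
  have z3 := ind3.integral_fun_mul_eq_mul_integral (by fun_prop) (by fun_prop)
  have z4 : ∫ ω, (X ω ^ 2 - 1) * |Y ω| ^ 3 ∂μ = 0 := by
    rw [ind4.integral_fun_mul_eq_mul_integral (by fun_prop) (by fun_prop), zX, zero_mul]
  refine ⟨iL1, iL2, ?_⟩
  have hpt (ω : Ω) : X ω * Y ω * f (R ω + 2 * X ω * Y ω) - 2 * Y ω ^ 2 * f' (R ω + 2 * X ω * Y ω) ≤
      (X ω * (Y ω * f (R ω)) + (X ω ^ 2 - 1) * (2 * Y ω ^ 2 * f' (R ω))) +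
        (28 / 5 * (|X ω| ^ 3 * |Y ω| ^ 3) - 24 / 5 * ((X ω ^ 2 - 1) * |Y ω| ^ 3)) := by
    have hd (t : ℝ) : HasDerivAt (fun t => Y ω * f (R ω + 2 * t * Y ω))
        (2 * Y ω ^ 2 * f' (R ω + 2 * t * Y ω)) t := by
      have h1 : HasDerivAt (fun t => R ω + 2 * t * Y ω) (2 * Y ω) t :=
        ((((hasDerivAt_id t).const_mul 2).mul_const (Y ω)).const_add (R ω)).congr_deriv (by simp)
      exact (((hf _).comp t h1).const_mul (Y ω)).congr_deriv (by ring)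
    have hl (s t : ℝ) : |2 * Y ω ^ 2 * f' (R ω + 2 * s * Y ω) -
        2 * Y ω ^ 2 * f' (R ω + 2 * t * Y ω)| ≤ 8 * |Y ω| ^ 3 * |s - t| := by
      rw [← mul_sub, abs_mul, abs_of_nonneg (by positivity : 0 ≤ 2 * Y ω ^ 2), ← sq_abs]
      have h := hf2 (R ω + 2 * s * Y ω) (R ω + 2 * t * Y ω)
      have e : R ω + 2 * s * Y ω - (R ω + 2 * t * Y ω) = 2 * Y ω * (s - t) := by ring
      rw [e, abs_mul, abs_mul, abs_two] at h
      calc _ ≤ 2 * |Y ω| ^ 2 * (2 * (2 * |Y ω| * |s - t|)) := by gcongr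
        _ = _ := by ring
    have h := stein_pointwise_bound hd hl (X ω)
    simp only [mul_zero, zero_mul, add_zero] at h
    linarith
  have i12 : Integrable (fun ω => X ω * (Y ω * f (R ω)) +
      (X ω ^ 2 - 1) * (2 * Y ω ^ 2 * f' (R ω))) μ := i1.add i2
  have i34 : Integrable (fun ω => 28 / 5 * (|X ω| ^ 3 * |Y ω| ^ 3) -
      24 / 5 * ((X ω ^ 2 - 1) * |Y ω| ^ 3)) μ := (i3.const_mul _).sub (i4.const_mul _)
  refine (integral_mono (iL1.sub iL2) (i12.add i34) hpt).trans (le_of_eq ?_)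
  rw [integral_add' i12 i34, integral_add i1 i2, integral_sub (i3.const_mul _) (i4.const_mul _),
    integral_const_mul, integral_const_mul, z1, z2, z3, z4]
  ring

end LeaveOneOut

section QuadraticForm

variable {ι : Type*} [Fintype ι] [DecidableEq ι] {a : ι → ι → ℝ}

lemma quadratic_form_eq_update (hsymm : ∀ k l, a k l = a l k) (hdiag : ∀ k, a k k = 0)
    (x : ι → ℝ) (k : ι) :
    ∑ i, ∑ j, a i j * x i * x j =
      (∑ i, ∑ j, a i j * Function.update x k 0 i * Function.update x k 0 j) +
        2 * x k * ∑ l, a k l * x l := by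
  set y := Function.update x k 0 with hy
  have hyk : y k = 0 := Function.update_self ..
  have hx {i : ι} (hi : i ≠ k) : x i = y i := (Function.update_of_ne hi ..).symm
  have hk : ∑ l, a k l * x l = ∑ l, a k l * y l := Finset.sum_congr rfl fun l _ => by
    by_cases hl : l = k
    · simp [hl, hdiag]
    · rw [hx hl]
  have e (i j : ι) : a i j * x i * x j = a i j * y i * y j +
      ((if i = k then x k * (a k j * y j) else 0) + if j = k then x k * (a k i * x i) else 0) := by
    by_cases hj : j = k <;> by_cases hi : i = k
    · simp [hi, hj, hdiag]
    · rw [hj, if_neg hi, if_pos rfl, hyk, hsymm i k]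
      ring
    · rw [hi, if_pos rfl, if_neg hj, hyk, hx hj]
      ring
    · rw [if_neg hi, if_neg hj, hx hi, hx hj]
      ring
  simp only [e, Finset.sum_add_distrib, Finset.sum_ite_eq', Finset.mem_univ, if_true]
  rw [Finset.sum_comm (f := fun i j => if i = k then x k * (a k j * y j) else 0)]
  simp only [Finset.sum_ite_eq', Finset.mem_univ, if_true, ← Finset.mul_sum, hk]
  ring

variable {Ω : Type*} {mΩ : MeasurableSpace Ω} {μ : Measure Ω} [IsProbabilityMeasure μ]
  {X : ι → Ω → ℝ} {m4 : ℝ} {f f' : ℝ → ℝ}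

lemma integral_leave_one_out_quadratic_form_le (hX : iIndepFun X μ) (hm : ∀ i, Measurable (X i))
    (hc : ∀ k, ∫ ω, X k ω ∂μ = 0) (hv : ∀ k, ∫ ω, X k ω ^ 2 ∂μ = 1)
    (h4 : ∀ k, MemLp (X k) 4 μ) (hm4 : ∀ k, ∫ ω, X k ω ^ 4 ∂μ = m4) (hm0 : 0 ≤ m4)
    (hsymm : ∀ k l, a k l = a l k) (hdiag : ∀ k, a k k = 0)
    (hf : ∀ x, HasDerivAt f (f' x) x) (hf1 : ∀ x, |f' x| ≤ 1)
    (hf2 : ∀ x y, |f' x - f' y| ≤ 2 * |x - y|) (k : ι) :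
    Integrable (fun ω => X k ω * (∑ l, a k l * X l ω) *
      f (∑ i, ∑ j, a i j * X i ω * X j ω)) μ ∧
    Integrable (fun ω => 2 * (∑ l, a k l * X l ω) ^ 2 *
      f' (∑ i, ∑ j, a i j * X i ω * X j ω)) μ ∧
    ∫ ω, (X k ω * (∑ l, a k l * X l ω) * f (∑ i, ∑ j, a i j * X i ω * X j ω) -
      2 * (∑ l, a k l * X l ω) ^ 2 * f' (∑ i, ∑ j, a i j * X i ω * X j ω)) ∂μ ≤
      28 / 5 * (√(3 * m4 + m4 ^ 2) * ((∑ l, a k l ^ 2) * √(∑ l, a k l ^ 2))) := by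
  set Y : Ω → ℝ := fun ω => ∑ l, a k l * X l ω with hY
  set R : Ω → ℝ := fun ω => ∑ i, ∑ j, a i j * Function.update (fun i => X i ω) k 0 i *
    Function.update (fun i => X i ω) k 0 j with hR
  have hYupd (ω : Ω) : Y ω = ∑ l, a k l * Function.update (fun i => X i ω) k 0 l := by
    refine Finset.sum_congr rfl fun l _ => ?_
    by_cases hl : l = k
    · simp [hl, hdiag]
    · simp [hl]
  have hQ (ω : Ω) : ∑ i, ∑ j, a i j * X i ω * X j ω = R ω + 2 * X k ω * Y ω :=
    quadratic_form_eq_update hsymm hdiag (fun i => X i ω) k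
  have hind : IndepFun (X k) (fun ω => (Y ω, R ω)) μ := by
    have h := (hX.indepFun_update hm k).comp (φ := fun x : ℝ => x)
      (ψ := fun y : ι → ℝ => (∑ l, a k l * y l, ∑ i, ∑ j, a i j * y i * y j))
      (by fun_prop) (by fun_prop)
    simpa only [Function.comp_def, ← hYupd] using h
  have hY4 : MemLp Y 4 μ := memLp_linear_form h4 _
  have hYm : Measurable Y := by fun_prop
  have hupd (i : ι) : Measurable fun ω => Function.update (fun i => X i ω) k 0 i := by
    by_cases hi : i = k
    · simp [hi]
    · simpa [hi] using hm i
  have hRm : Measurable R := by fun_prop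
  have hR2 : MemLp R 2 μ := by
    refine memLp_quadratic_form (X := fun i ω => Function.update (fun i => X i ω) k 0 i)
      (fun i => ?_) a
    by_cases hi : i = k
    · simp [hi]
    · simpa [hi] using h4 i
  simp only [hQ]
  obtain ⟨i1, i2, h⟩ := integral_leave_one_out_le hind (h4 k) hY4 hR2 (hm k) hYm hRm (hc k) (hv k)
    hf hf1 hf2
  refine ⟨i1, i2, h.trans ?_⟩
  have hX3 := integral_abs_pow_three_le (h4 k)
  rw [hv, hm4, one_mul] at hX3
  have hs : 0 ≤ ∑ l, a k l ^ 2 := Finset.sum_nonneg fun _ _ => sq_nonneg _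
  have hY3 : ∫ ω, |Y ω| ^ 3 ∂μ ≤ √(3 + m4) * ((∑ l, a k l ^ 2) * √(∑ l, a k l ^ 2)) := by
    refine (integral_abs_pow_three_le hY4).trans ?_
    rw [integral_sq_linear_form hX hm hc hv h4]
    refine (Real.sqrt_le_sqrt (mul_le_mul_of_nonneg_left
      (integral_pow_four_linear_form_le hX hm hc hv h4 hm4 hm0 _) hs)).trans (le_of_eq ?_)
    rw [show ∀ s : ℝ, s * ((3 + m4) * s ^ 2) = (3 + m4) * (s ^ 2 * s) from fun s => by ring,
      Real.sqrt_mul (by positivity), Real.sqrt_mul (by positivity), Real.sqrt_sq hs]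
  rw [show 3 * m4 + m4 ^ 2 = m4 * (3 + m4) by ring, Real.sqrt_mul hm0, mul_assoc √m4]
  have : 0 ≤ ∫ ω, |Y ω| ^ 3 ∂μ := integral_nonneg fun ω => by positivity
  gcongr

lemma integral_sq_one_sub_le (hX : iIndepFun X μ) (hm : ∀ i, Measurable (X i))
    (hc : ∀ k, ∫ ω, X k ω ∂μ = 0) (hv : ∀ k, ∫ ω, X k ω ^ 2 ∂μ = 1)
    (h4 : ∀ k, MemLp (X k) 4 μ) (hm4 : ∀ k, ∫ ω, X k ω ^ 4 ∂μ = m4)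
    (hsymm : ∀ k l, a k l = a l k) (ha : ∑ k, ∑ l, a k l ^ 2 = 1 / 2) :
    MemLp (fun ω => ∑ k, 2 * (∑ l, a k l * X l ω) ^ 2) 2 μ ∧
    ∫ ω, (1 - ∑ k, 2 * (∑ l, a k l * X l ω) ^ 2) ^ 2 ∂μ ≤
      4 * m4 * ∑ k, (∑ l, a k l ^ 2) ^ 2 + 8 * ∑ l, ∑ p, (∑ k, a k l * a k p) ^ 2 := by
  set b : ι → ι → ℝ := fun l p => 2 * ∑ k, a k l * a k p with hb
  have hV (ω : Ω) : ∑ k, 2 * (∑ l, a k l * X l ω) ^ 2 = ∑ l, ∑ p, b l p * X l ω * X p ω := by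
    simp only [hb, sq, Finset.mul_sum, Finset.sum_mul]
    rw [Finset.sum_comm]
    refine Finset.sum_congr rfl fun l _ => ?_
    rw [Finset.sum_comm]
    exact Finset.sum_congr rfl fun p _ => Finset.sum_congr rfl fun k _ => by ring
  have hVL : MemLp (fun ω => ∑ k, 2 * (∑ l, a k l * X l ω) ^ 2) 2 μ := by
    simpa only [hV] using memLp_quadratic_form h4 b
  refine ⟨hVL, ?_⟩
  have hVint : ∫ ω, ∑ k, 2 * (∑ l, a k l * X l ω) ^ 2 ∂μ = 1 := by
    rw [integral_finsetSum _ fun k _ =>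
      ((memLp_linear_form h4 (a k)).two_of_four.integrable_sq.const_mul 2)]
    simp only [integral_const_mul, integral_sq_linear_form hX hm hc hv h4]
    rw [← Finset.mul_sum, ha]
    norm_num
  have hbdiag (l : ι) : b l l = 2 * ∑ k, a l k ^ 2 := by
    simp only [hb, sq, hsymm l]
  have hbsymm (l p : ι) : b l p * b p l = b l p ^ 2 := by
    simp only [hb, mul_comm (a _ p), sq]
  have htr : ∑ l, b l l = 1 := by
    simp only [hbdiag]
    rw [← Finset.mul_sum, ha]
    norm_num
  have hVsq := integral_sq_quadratic_form hX hm hc hv h4 hm4 b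
  simp only [← hV, htr, hbsymm] at hVsq
  have e (ω : Ω) : (1 - ∑ k, 2 * (∑ l, a k l * X l ω) ^ 2) ^ 2 =
      (1 - 2 * ∑ k, 2 * (∑ l, a k l * X l ω) ^ 2) + (∑ k, 2 * (∑ l, a k l * X l ω) ^ 2) ^ 2 := by
    ring
  have hVi := (hVL.integrable one_le_two).const_mul 2
  have i1 : Integrable (fun ω => 1 - 2 * ∑ k, 2 * (∑ l, a k l * X l ω) ^ 2) μ :=
    (integrable_const _).sub hVi
  simp only [e]
  rw [integral_add i1 hVL.integrable_sq, integral_sub (integrable_const _) hVi, integral_const_mul,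
    hVint, hVsq]
  have e1 : ∑ i, b i i ^ 2 = 4 * ∑ k, (∑ l, a k l ^ 2) ^ 2 := by
    rw [Finset.mul_sum]
    exact Finset.sum_congr rfl fun l _ => by rw [hbdiag]; ring
  have e2 : ∑ i, ∑ j, b i j ^ 2 = 4 * ∑ l, ∑ p, (∑ k, a k l * a k p) ^ 2 := by
    simp only [hb, mul_pow, ← Finset.mul_sum]
    norm_num
  have h0 : 0 ≤ ∑ k, (∑ l, a k l ^ 2) ^ 2 := Finset.sum_nonneg fun _ _ => sq_nonneg _
  rw [e1, e2]
  simp only [integral_const, probReal_univ, smul_eq_mul]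
  linarith

lemma integral_mul_sub_deriv_le (hX : iIndepFun X μ) (hm : ∀ i, Measurable (X i))
    (hc : ∀ k, ∫ ω, X k ω ∂μ = 0) (hv : ∀ k, ∫ ω, X k ω ^ 2 ∂μ = 1)
    (h4 : ∀ k, MemLp (X k) 4 μ) (hm4 : ∀ k, ∫ ω, X k ω ^ 4 ∂μ = m4) (hm0 : 0 ≤ m4)
    (hsymm : ∀ k l, a k l = a l k) (hdiag : ∀ k, a k k = 0) (ha : ∑ k, ∑ l, a k l ^ 2 = 1 / 2)
    {L : ℝ} (hL : ∀ k, ∑ l, a k l ^ 2 ≤ L)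
    (hf : ∀ x, HasDerivAt f (f' x) x) (hf1 : ∀ x, |f' x| ≤ 1)
    (hf2 : ∀ x y, |f' x - f' y| ≤ 2 * |x - y|) :
    ∫ ω, ((∑ i, ∑ j, a i j * X i ω * X j ω) * f (∑ i, ∑ j, a i j * X i ω * X j ω) -
      f' (∑ i, ∑ j, a i j * X i ω * X j ω)) ∂μ ≤
      √(4 * m4 * ∑ k, (∑ l, a k l ^ 2) ^ 2 + 8 * ∑ l, ∑ p, (∑ k, a k l * a k p) ^ 2) +
        14 / 5 * (√(3 * m4 + m4 ^ 2) * √L) := by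
  have hterm := integral_leave_one_out_quadratic_form_le hX hm hc hv h4 hm4 hm0 hsymm hdiag
    hf hf1 hf2
  obtain ⟨hVL, hV⟩ := integral_sq_one_sub_le hX hm hc hv h4 hm4 hsymm ha
  set Q : Ω → ℝ := fun ω => ∑ i, ∑ j, a i j * X i ω * X j ω with hQ
  have hWL : MemLp (fun ω => 1 - ∑ k, 2 * (∑ l, a k l * X l ω) ^ 2) 2 μ :=
    (memLp_const 1).sub hVL
  have hiW := (hWL.integrable one_le_two).abs
  have hi (k : ι) : Integrable (fun ω => X k ω * (∑ l, a k l * X l ω) * f (Q ω) -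
      2 * (∑ l, a k l * X l ω) ^ 2 * f' (Q ω)) μ := (hterm k).1.sub (hterm k).2.1
  have hpt (ω : Ω) : Q ω * f (Q ω) - f' (Q ω) ≤
      |1 - ∑ k, 2 * (∑ l, a k l * X l ω) ^ 2| +
        ∑ k, (X k ω * (∑ l, a k l * X l ω) * f (Q ω) -
          2 * (∑ l, a k l * X l ω) ^ 2 * f' (Q ω)) := by
    have e : Q ω = ∑ k, X k ω * ∑ l, a k l * X l ω := by
      simp only [hQ, Finset.mul_sum]
      exact Finset.sum_congr rfl fun k _ => Finset.sum_congr rfl fun l _ => by ring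
    rw [Finset.sum_sub_distrib, ← Finset.sum_mul, ← Finset.sum_mul, ← e]
    have h := neg_le_abs ((1 - ∑ k, 2 * (∑ l, a k l * X l ω) ^ 2) * f' (Q ω))
    rw [abs_mul] at h
    have := h.trans (mul_le_of_le_one_right (abs_nonneg _) (hf1 _))
    linarith
  have hfc' : Continuous f' := continuous_of_abs_sub_le zero_le_two hf2
  have hQ2 : MemLp Q 2 μ := memLp_quadratic_form h4 a
  have hL1 : Integrable (fun ω => Q ω * f (Q ω) - f' (Q ω)) μ := by
    have h1 : Integrable (fun ω => Q ω * f (Q ω)) μ :=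
      hQ2.integrable_mul (hQ2.comp_of_abs_sub_le (abs_sub_le_of_abs_deriv_le_one hf hf1))
    have h2 := (integrable_const (μ := μ) (1 : ℝ)).mul_comp_of_abs_le_one hQ2.1 hfc' hf1
    simp only [one_mul] at h2
    exact h1.sub h2
  have hsum : ∑ k, 28 / 5 * (√(3 * m4 + m4 ^ 2) * ((∑ l, a k l ^ 2) * √(∑ l, a k l ^ 2))) ≤
      14 / 5 * (√(3 * m4 + m4 ^ 2) * √L) := by
    calc _ ≤ ∑ k, 28 / 5 * (√(3 * m4 + m4 ^ 2) * ((∑ l, a k l ^ 2) * √L)) := by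
          gcongr with k
          exact hL k
      _ = _ := by
          rw [← Finset.mul_sum, ← Finset.mul_sum, ← Finset.sum_mul, ha]
          ring
  refine (integral_mono hL1 (hiW.add (integrable_finsetSum _ fun k _ => hi k)) hpt).trans ?_
  rw [integral_add' hiW (integrable_finsetSum _ fun k _ => hi k),
    integral_finsetSum _ fun k _ => hi k]
  exact add_le_add ((integral_abs_le_sqrt hWL).trans (Real.sqrt_le_sqrt hV))
    ((Finset.sum_le_sum fun k _ => (hterm k).2.2).trans hsum)

end QuadraticForm

lemma abs_integral_comp_sub_integral_gaussianReal_le {Ω : Type*} {mΩ : MeasurableSpace Ω}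
    {μ : Measure Ω} [IsProbabilityMeasure μ] {Y : Ω → ℝ} (hY : Integrable Y μ) {B : ℝ}
    (hB : ∀ f f' : ℝ → ℝ, (∀ x, HasDerivAt f (f' x) x) → (∀ x, |f' x| ≤ 1) →
      (∀ x y, |f' x - f' y| ≤ 2 * |x - y|) → ∫ ω, (Y ω * f (Y ω) - f' (Y ω)) ∂μ ≤ B)
    {h : ℝ → ℝ} (hh : LipschitzWith 1 h) :
    |∫ ω, h (Y ω) ∂μ - ∫ y, h y ∂(gaussianReal 0 1)| ≤ B := by
  have key {h : ℝ → ℝ} (hh : LipschitzWith 1 h) :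
      ∫ y, h y ∂(gaussianReal 0 1) - ∫ ω, h (Y ω) ∂μ ≤ B := by
    obtain ⟨f, f', hf, hf1, hf2, hs⟩ := exists_stein_solution hh
    have e (ω : Ω) : Y ω * f (Y ω) - f' (Y ω) =
        ∫ y, h y ∂(gaussianReal 0 1) - h (Y ω) := by linarith [hs (Y ω)]
    have := hB f f' hf hf1 hf2
    simp only [e] at this
    rwa [integral_sub (integrable_const _) (hh.integrable_comp hY), integral_const,
      probReal_univ, one_smul] at this
  have h2 := key hh.neg
  simp only [Pi.neg_apply, integral_neg] at h2
  exact abs_le.2 ⟨by linarith [key hh], by linarith⟩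

lemma dW_map_gaussian_le {Ω : Type*} {mΩ : MeasurableSpace Ω}
    {μ : Measure Ω} [IsProbabilityMeasure μ] {Y : Ω → ℝ} (hY : Integrable Y μ) {B : ℝ}
    (hB : ∀ f f' : ℝ → ℝ, (∀ x, HasDerivAt f (f' x) x) → (∀ x, |f' x| ≤ 1) →
      (∀ x y, |f' x - f' y| ≤ 2 * |x - y|) → ∫ ω, (Y ω * f (Y ω) - f' (Y ω)) ∂μ ≤ B) :
    dW (μ.map Y) stdGaussian ≤ B := by
  have : Nonempty {f : ℝ → ℝ // LipschitzWith 1 f} := ⟨⟨id, LipschitzWith.id⟩⟩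
  refine ciSup_le fun h => ?_
  rw [integral_map hY.1.aemeasurable h.2.continuous.aestronglyMeasurable]
  exact abs_integral_comp_sub_integral_gaussianReal_le hY hB h.2

end Auxiliary

theorem quadratic_form_wasserstein_bound_Ln
    {Ω : Type*} [MeasureSpace Ω] [IsProbabilityMeasure (ℙ : Measure Ω)]
    (n : ℕ) (X : Fin n → Ω → ℝ) (a : Fin n → Fin n → ℝ)
    (hmeas : ∀ k, Measurable (X k))
    (hindep : iIndepFun X ℙ)
    (hiid : ∀ k l, IdentDistrib (X k) (X l) ℙ ℙ)
    (hcentered : ∀ k, ∫ ω, X k ω = 0)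
    (hvar : ∀ k, ∫ ω, (X k ω) ^ 2 = 1)
    (h4int : ∀ k, Integrable (fun ω => (X k ω) ^ 4))
    (m4 : ℝ) (hm4 : ∀ k, ∫ ω, (X k ω) ^ 4 = m4)
    (hsymm : ∀ k l, a k l = a l k) (hdiag : ∀ k, a k k = 0)
    (hnonzero : ∃ k l, a k l ≠ 0)
    (hQvar : ∫ ω, (∑ k, ∑ l, a k l * X k ω * X l ω) ^ 2 = 1)
    (L2 : ℝ) (hL2 : IsGreatest {x : ℝ | ∃ k : Fin n, x = ∑ l, (a k l) ^ 2} L2) :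
    dW (Measure.map (fun ω => ∑ k, ∑ l, a k l * X k ω * X l ω) ℙ) stdGaussian ≤
      2 * Real.sqrt n * L2 *
        (Real.sqrt (m4 + 2 / (n * L2 ^ 2) * ∑ l, ∑ p, (∑ k, a k l * a k p) ^ 2) +
          2 * Real.sqrt (3 * m4 + m4 ^ 2)) := by
  have h4 (k : Fin n) : MemLp (X k) 4 ℙ := memLp_four_of_integrable (hmeas k) (h4int k)
  obtain ⟨⟨k₀, hk₀⟩, hub⟩ := hL2
  have hL (k : Fin n) : ∑ l, a k l ^ 2 ≤ L2 := hub ⟨k, rfl⟩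
  have hs (k : Fin n) : 0 ≤ ∑ l, a k l ^ 2 := Finset.sum_nonneg fun _ _ => sq_nonneg _
  have hm0 : 0 ≤ m4 := by
    rw [← hm4 k₀]
    exact integral_nonneg fun ω => by positivity
  have ha : ∑ k, ∑ l, a k l ^ 2 = 1 / 2 := by
    have h := integral_sq_quadratic_form hindep hmeas hcentered hvar h4 hm4 a
    have e (k l : Fin n) : a k l * a l k = a k l ^ 2 := by rw [hsymm l k, sq]
    simp only [hQvar, e, hdiag] at h
    simp only [Finset.sum_const_zero, ne_eq, OfNat.ofNat_ne_zero, not_false_eq_true, zero_pow,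
      mul_zero] at h
    linarith
  have hnL : 1 / 2 ≤ n * L2 := by
    rw [← ha]
    simpa using Finset.sum_le_sum fun (k : Fin n) (_ : k ∈ Finset.univ) => hL k
  have hL0 : 0 ≤ L2 := (hs k₀).trans (hL k₀)
  have hLpos : 0 < L2 := hL0.lt_of_ne fun h => by rw [← h] at hnL; norm_num at hnL
  have hn : (0 : ℝ) < n := Nat.cast_pos.2 k₀.pos
  refine dW_map_gaussian_le ((memLp_quadratic_form h4 a).integrable one_le_two)
    fun f f' hf hf1 hf2 => (integral_mul_sub_deriv_le hindep hmeas hcentered hvar h4 hm4 hm0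
      hsymm hdiag ha hL hf hf1 hf2).trans ?_
  rw [mul_add]
  refine add_le_add ?_ ?_
  · have hsq : ∑ k, (∑ l, a k l ^ 2) ^ 2 ≤ n * L2 ^ 2 := by
      simpa using Finset.sum_le_sum fun (k : Fin n) (_ : k ∈ Finset.univ) =>
        pow_le_pow_left₀ (hs k) (hL k) 2
    refine Real.sqrt_le_iff.2 ⟨by positivity, ?_⟩
    rw [mul_pow, mul_pow, mul_pow, Real.sq_sqrt hn.le, Real.sq_sqrt (by positivity)]
    have e : 2 ^ 2 * (n : ℝ) * L2 ^ 2 *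
        (m4 + 2 / (n * L2 ^ 2) * ∑ l, ∑ p, (∑ k, a k l * a k p) ^ 2) =
        4 * m4 * (n * L2 ^ 2) + 8 * ∑ l, ∑ p, (∑ k, a k l * a k p) ^ 2 := by
      field_simp
      ring
    rw [e]
    gcongr
  · have h : 14 / 5 * √L2 ≤ 4 * √n * L2 := by
      have h1 : 7 / 10 ≤ √n * √L2 := by
        rw [← Real.sqrt_mul hn.le]
        exact Real.le_sqrt_of_sq_le (by linarith)
      calc 14 / 5 * √L2 = 4 * (7 / 10) * √L2 := by ring
        _ ≤ 4 * (√n * √L2) * √L2 := by gcongr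
        _ = 4 * √n * L2 := by rw [mul_assoc, mul_assoc, Real.mul_self_sqrt hL0, mul_assoc]
    calc 14 / 5 * (√(3 * m4 + m4 ^ 2) * √L2) = 14 / 5 * √L2 * √(3 * m4 + m4 ^ 2) := by ring
      _ ≤ 4 * √n * L2 * √(3 * m4 + m4 ^ 2) := by gcongr
      _ = _ := by ring
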